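/- For all constants A > 0 and 0 < c < C with A² + c < C, there exists c₁ > 0 such that for all r > 0, all a ∈ (0, A], α := a√r, and all ξ ∈ [α² + c r, C r]: c₁·√ξ ≤ μ_α(ξ) ≤ (1/π)·√ξ. (These two-sided bounds on the mean counting function are used in verifying the rigidity assumptions for the large-α Bessel process.) -/

import Mathlib

/-- `μ_α(ξ) = (1/π) ∫_{α²}^{ξ} √(u-α²)/(2u) du`, the mean of the counting function of the
Bessel point process with parameter `α`. -/
noncomputable def besselMean (α ξ : ℝ) : ℝ :=
  (1 / Real.pi) * ∫ u in (α ^ 2)..ξ, Real.sqrt (u - α ^ 2) / (2 * u)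

theorem continuousOn_besselMean_integrand {s : ℝ} (hs : 0 < s) (ξ : ℝ) :
    ContinuousOn (fun u : ℝ => Real.sqrt (u - s) / (2 * u)) (Set.Icc s ξ) :=
  ContinuousOn.div (by fun_prop) (by fun_prop) fun u hu => by
    have : 0 < u := hs.trans_le hu.1
    positivity

theorem intervalIntegrable_besselMean_integrand {s ξ : ℝ} (hs : 0 < s) (h : s ≤ ξ) :
    IntervalIntegrable (fun u : ℝ => Real.sqrt (u - s) / (2 * u)) MeasureTheory.volume s ξ :=
  (continuousOn_besselMean_integrand hs ξ).intervalIntegrable_of_Icc h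

theorem integral_sqrt_sub_div_le {s ξ : ℝ} (hs : 0 < s) (h : s ≤ ξ) :
    ∫ u in s..ξ, Real.sqrt (u - s) / (2 * u) ≤ Real.sqrt ξ - Real.sqrt s := by
  have hpos : ∀ u ∈ Set.Icc s ξ, 0 < u := fun u hu => hs.trans_le hu.1
  have hint : IntervalIntegrable (fun u : ℝ => 1 / (2 * Real.sqrt u))
      MeasureTheory.volume s ξ := by
    refine ContinuousOn.intervalIntegrable_of_Icc h
      (ContinuousOn.div (by fun_prop) (by fun_prop) fun u hu => ?_)
    have := Real.sqrt_pos.2 (hpos u hu)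
    positivity
  rw [← intervalIntegral.integral_eq_sub_of_hasDerivAt (f := Real.sqrt)
    (fun u hu => Real.hasDerivAt_sqrt (hpos u (Set.uIcc_of_le h ▸ hu)).ne') hint]
  refine intervalIntegral.integral_mono_on h
    (intervalIntegrable_besselMean_integrand hs h) hint fun u hu => ?_
  have hu0 := hpos u hu
  have hsq := Real.sqrt_pos.2 hu0
  have hle : Real.sqrt (u - s) ≤ Real.sqrt u := Real.sqrt_le_sqrt (by linarith)
  rw [div_le_div_iff₀ (by positivity) (by positivity)]
  nlinarith [Real.mul_self_sqrt hu0.le]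

theorem integral_sqrt_sub (s ξ : ℝ) (h : s ≤ ξ) :
    ∫ u in s..ξ, Real.sqrt (u - s) = 2 / 3 * ((ξ - s) * Real.sqrt (ξ - s)) := by
  rw [intervalIntegral.integral_comp_sub_right (fun u => Real.sqrt u) s, sub_self]
  simp_rw [Real.sqrt_eq_rpow]
  rw [integral_rpow (Or.inl (by norm_num)), Real.rpow_add_one' (by linarith) (by norm_num),
    Real.zero_rpow (by norm_num)]
  ring

theorem le_integral_sqrt_sub_div {s ξ : ℝ} (hs : 0 < s) (h : s ≤ ξ) :
    (ξ - s) * Real.sqrt (ξ - s) / (3 * ξ) ≤ ∫ u in s..ξ, Real.sqrt (u - s) / (2 * u) := by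
  have hξ : 0 < ξ := hs.trans_le h
  have heq : (ξ - s) * Real.sqrt (ξ - s) / (3 * ξ) = ∫ u in s..ξ, Real.sqrt (u - s) / (2 * ξ) := by
    rw [intervalIntegral.integral_div, integral_sqrt_sub s ξ h]
    field_simp
  rw [heq]
  refine intervalIntegral.integral_mono_on h
    (Continuous.intervalIntegrable (by fun_prop) _ _)
    (intervalIntegrable_besselMean_integrand hs h) fun u hu => ?_
  have hu0 : 0 < u := hs.trans_le hu.1
  have := hu.2
  gcongr

/-- Two-sided bounds on the mean counting function of the large-`α` Bessel process:
there is `c₁ > 0` such that `c₁ √ξ ≤ μ_α(ξ) ≤ (1/π) √ξ` whenever `α = a√r`, `a ∈ (0, A]`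
and `ξ ∈ [α² + cr, Cr]`. -/
theorem besselMean_two_sided_bounds (A c C : ℝ)
    (hA : 0 < A) (hc : 0 < c) (hcC : c < C) (hAC : A ^ 2 + c < C) :
    ∃ c₁ > (0 : ℝ), ∀ r > (0 : ℝ), ∀ a ∈ Set.Ioc (0 : ℝ) A,
      ∀ ξ ∈ Set.Icc ((a * Real.sqrt r) ^ 2 + c * r) (C * r),
        c₁ * Real.sqrt ξ ≤ besselMean (a * Real.sqrt r) ξ ∧
          besselMean (a * Real.sqrt r) ξ ≤ (1 / Real.pi) * Real.sqrt ξ := by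
  have hC : 0 < C := hc.trans hcC
  have hk : 0 < c / C := div_pos hc hC
  refine ⟨1 / Real.pi * (c / C * Real.sqrt (c / C) / 3),
    by have := Real.sqrt_pos.2 hk; positivity, ?_⟩
  rintro r hr a ⟨ha, -⟩ ξ ⟨hξ₁, hξ₂⟩
  have hs : 0 < (a * Real.sqrt r) ^ 2 := by positivity
  unfold besselMean
  generalize (a * Real.sqrt r) ^ 2 = s at *
  have hcr : 0 < c * r := mul_pos hc hr
  have hsξ : s ≤ ξ := by linarith
  have hξ : 0 < ξ := hs.trans_le hsξ
  have hgap : c / C * ξ ≤ ξ - s := by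
    calc c / C * ξ ≤ c / C * (C * r) := by gcongr
      _ = c * r := by field_simp
      _ ≤ ξ - s := by linarith
  constructor
  · rw [mul_assoc]
    gcongr
    refine le_trans ?_ (le_integral_sqrt_sub_div hs hsξ)
    calc c / C * Real.sqrt (c / C) / 3 * Real.sqrt ξ
        = c / C * ξ * Real.sqrt (c / C * ξ) / (3 * ξ) := by
          rw [Real.sqrt_mul hk.le]
          field_simp
      _ ≤ (ξ - s) * Real.sqrt (ξ - s) / (3 * ξ) := by
          have : 0 ≤ ξ - s := by linarith
          gcongr
  · gcongr
    linarith [integral_sqrt_sub_div_le hs hsξ, Real.sqrt_nonneg s]
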